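/- Let V be a finite-dimensional complex vector space with a nondegenerate quadratic form Q, and let V = M ⊕ N be a decomposition orthogonal for the associated bilinear form, with Q_M and Q_N the (nondegenerate) restrictions of Q to M and N. Assume dim V is even and dim M is odd. Then for every finite-dimensional simple module S over the Clifford algebra C(Q), there exist two non-isomorphic simple C(Q_M)-modules S⁺ and S⁻ such that S, viewed as a C(Q_M)-module via the algebra homomorphism C(Q_M) → C(Q) induced by the isometric inclusion M ↪ V, is isomorphic to the direct sum of 2^{(dim N − 1)/2} copies of S⁺ ⊕ S⁻. -/

import Mathlib

/-- The restriction of a quadratic form `Q` on `V` to a subspace `M ⊆ V`. -/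
noncomputable def qfRes {V : Type} [AddCommGroup V] [Module ℂ V]
    (Q : QuadraticForm ℂ V) (M : Submodule ℂ V) : QuadraticForm ℂ M :=
  Q.comp M.subtype

/-- The isometric inclusion `M ↪ V` of quadratic spaces, inducing
`C(Q_M) → C(Q)` on Clifford algebras. -/
noncomputable def qfIncl {V : Type} [AddCommGroup V] [Module ℂ V]
    (Q : QuadraticForm ℂ V) (M : Submodule ℂ V) : qfRes Q M →qᵢ Q where
  toLinearMap := M.subtype
  map_app' _ := rfl


def CF {A : Type} [Ring A] (e : ℕ → A) (n : ℕ) : Prop :=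
  (∀ i < n, e i * e i = 1) ∧ ∀ i < n, ∀ j < n, i ≠ j → e i * e j = - (e j * e i)

theorem CF.mono {A : Type} [Ring A] {e : ℕ → A} {m n : ℕ} (h : CF e n) (hmn : m ≤ n) : CF e m :=
  ⟨fun i hi => h.1 i (by omega), fun i hi j hj => h.2 i (by omega) j (by omega)⟩

/-- model -/
def IsModel (k : ℕ) (K : Type) [AddCommGroup K] [Module ℂ K] (E : ℕ → Module.End ℂ K) : Prop :=
  CF E (2 * k) ∧ ∀ (X : Type) [AddCommGroup X] [Module ℂ X] [FiniteDimensional ℂ X]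
    (e : ℕ → Module.End ℂ X), CF e (2 * k) →
    ∃ (m : ℕ) (φ : X ≃ₗ[ℂ] (Fin m → K)), ∀ i < 2 * k, ∀ x j, φ (e i x) j = E i (φ x j)

theorem exists_model (k : ℕ) : ∃ (K : Type) (_ : AddCommGroup K) (_ : Module ℂ K)
    (_ : FiniteDimensional ℂ K) (E : ℕ → Module.End ℂ K),
    Module.finrank ℂ K = 2 ^ k ∧ IsModel k K E := by
  induction k with
  | zero =>
    refine ⟨ℂ, inferInstance, inferInstance, inferInstance, fun _ => 0, by simp, ⟨by simp, by simp⟩, ?_⟩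
    intro X _ _ _ e he
    exact ⟨_, (Module.finBasis ℂ X).equivFun, by simp⟩
  | succ k ih =>
    obtain ⟨K, _, _, _, E, hK, hE, hU⟩ := ih
    let E' : ℕ → Module.End ℂ (K × K) := fun i =>
      if i < 2 * k then (E i).prodMap (-(E i))
      else if i = 2 * k then (LinearMap.snd ℂ K K).prod (LinearMap.fst ℂ K K)
      else (Complex.I • LinearMap.snd ℂ K K).prod (-(Complex.I • LinearMap.fst ℂ K K))
    have E1 : ∀ i < 2 * k, ∀ x y, E' i (x, y) = (E i x, - E i y) := fun i hi x y => by
      simp [E', hi]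
    have E2 : ∀ x y, E' (2 * k) (x, y) = (y, x) := fun x y => by
      simp [E']
    have E3 : ∀ x y, E' (2 * k + 1) (x, y) = (Complex.I • y, - (Complex.I • x)) := fun x y => by
      simp [E']
    have cases : ∀ i < 2 * (k + 1), i < 2 * k ∨ i = 2 * k ∨ i = 2 * k + 1 := by omega
    have hE1 : ∀ i < 2 * k, ∀ x, E i (E i x) = x := fun i hi x => by
      have := congrArg (fun f => f x) (hE.1 i hi); simpa using this
    have hE2 : ∀ i < 2 * k, ∀ j < 2 * k, i ≠ j → ∀ x, E i (E j x) = - E j (E i x) :=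
      fun i hi j hj hij x => by
      have := congrArg (fun f => f x) (hE.2 i hi j hj hij); simpa using this
    refine ⟨K × K, inferInstance, inferInstance, inferInstance, E', ?_, ⟨?_, ?_⟩, ?_⟩
    · rw [Module.finrank_prod, hK]; ring
    · intro i hi
      apply LinearMap.ext
      rintro ⟨x, y⟩
      rw [Module.End.mul_apply]
      rcases cases i hi with h | rfl | rfl
      · simp [E1 i h, hE1 i h]
      · simp [E2]
      · simp [E3, smul_smul]
    · intro i hi j hj hij
      apply LinearMap.ext
      rintro ⟨x, y⟩
      rw [LinearMap.neg_apply, Module.End.mul_apply, Module.End.mul_apply]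
      rcases cases i hi with h | rfl | rfl <;> rcases cases j hj with h' | rfl | rfl
      · simp [E1 i h, E1 j h', hE2 i h j h' hij]
      · simp [E1 i h, E2]
      · simp [E1 i h, E3]
      · simp [E1 j h', E2]
      · exact absurd rfl hij
      · simp [E2, E3]
      · simp [E1 j h', E3]
      · simp [E2, E3]
      · exact absurd rfl hij
    · intro X _ _ _ e he
      have he1 : ∀ i < 2 * (k + 1), ∀ x, e i (e i x) = x := fun i hi x => by
        have := congrArg (fun f => f x) (he.1 i hi); simpa using this
      have he2 : ∀ i < 2 * (k + 1), ∀ j < 2 * (k + 1), i ≠ j → ∀ x, e i (e j x) = - e j (e i x) :=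
        fun i hi j hj hij x => by
        have := congrArg (fun f => f x) (he.2 i hi j hj hij); simpa using this
      obtain ⟨a, ha⟩ : ∃ a, a = e (2 * k) := ⟨_, rfl⟩
      obtain ⟨b, hb⟩ : ∃ b, b = e (2 * k + 1) := ⟨_, rfl⟩
      have haa : ∀ x, a (a x) = x := fun x => by rw [ha]; exact he1 _ (by omega) x
      have hbb : ∀ x, b (b x) = x := fun x => by rw [hb]; exact he1 _ (by omega) x
      have hba : ∀ x, b (a x) = - a (b x) := fun x => by
        rw [ha, hb]; exact he2 _ (by omega) _ (by omega) (by omega) x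
      have hea : ∀ i < 2 * k, ∀ x, e i (a x) = - a (e i x) := fun i hi x => by
        rw [ha]; exact he2 _ (by omega) _ (by omega) (by omega) x
      have heb : ∀ i < 2 * k, ∀ x, e i (b x) = - b (e i x) := fun i hi x => by
        rw [hb]; exact he2 _ (by omega) _ (by omega) (by omega) x
      let Y : Submodule ℂ X := LinearMap.ker (Complex.I • (a * b) - 1)
      have memY : ∀ x, x ∈ Y ↔ Complex.I • a (b x) = x := fun x => by
        simp [Y, sub_eq_zero]
      have heY : ∀ i < 2 * k, ∀ x ∈ Y, e i x ∈ Y := fun i hi x hx => by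
        rw [memY] at hx ⊢
        conv_rhs => rw [← hx]
        rw [map_smul, hea i hi, heb i hi]
        simp
      let e' : ℕ → Module.End ℂ Y := fun i =>
        if h : i < 2 * k then (e i).restrict (heY i h) else 0
      have he' : ∀ i < 2 * k, ∀ x : Y, (e' i x : X) = e i x := fun i hi x => by
        simp [e', hi]
      have hCF : CF e' (2 * k) := by
        refine ⟨fun i hi => ?_, fun i hi j hj hij => ?_⟩
        · ext x
          simp [he' i hi, he1 i (by omega)]
        · ext x
          simp [he' i hi, he' j hj, he2 i (by omega) j (by omega) hij]
      obtain ⟨m, ψ, hψ⟩ := hU Y e' hCF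
      let P : X →ₗ[ℂ] Y := LinearMap.codRestrict Y ((1/2 : ℂ) • (1 + Complex.I • (a * b))) (by
        intro x
        rw [memY]
        simp only [LinearMap.smul_apply, LinearMap.add_apply, Module.End.one_apply,
          Module.End.mul_apply, map_smul, map_add, hba, hbb, haa, map_neg, smul_add, smul_neg,
          smul_smul]
        rw [add_comm]
        congr 1
        · rw [← neg_smul]
          congr 1
          linear_combination (-(1/2) : ℂ) * Complex.I_mul_I
        · congr 1; ring)
      have hP : ∀ x, (P x : X) = (1/2 : ℂ) • (x + Complex.I • a (b x)) := fun x => rfl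
      let χ : X ≃ₗ[ℂ] Y × Y := LinearEquiv.ofLinearMap (P.prod (P ∘ₗ a))
        (Y.subtype.coprod (a ∘ₗ Y.subtype)) (by
          apply LinearMap.ext
          rintro ⟨⟨x, hx⟩, ⟨y, hy⟩⟩
          rw [memY] at hx hy
          have hx' : Complex.I • b x = a x := by
            conv_rhs => rw [← hx]
            rw [map_smul, haa]
          have hy' : Complex.I • b y = a y := by
            conv_rhs => rw [← hy]
            rw [map_smul, haa]
          refine Prod.ext (Subtype.ext ?_) (Subtype.ext ?_)
          · change (P (x + a y) : X) = x
            rw [hP]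
            simp only [hba, haa, map_add, map_neg, smul_add, smul_neg, hx, hy']
            module
          · change (P (a (x + a y)) : X) = y
            rw [hP]
            simp only [hba, haa, map_add, map_neg, smul_add, smul_neg, hx', hy]
            module) (by
          apply LinearMap.ext
          intro x
          change (P x : X) + a (P (a x)) = x
          simp only [hP, hba, haa, map_add, map_neg, smul_add, smul_neg, map_smul]
          module)
      have hχ : ∀ x, χ x = (P x, P (a x)) := fun x => rfl
      let θ : ((Fin m → K) × (Fin m → K)) ≃ₗ[ℂ] (Fin m → K × K) :=
        { toFun := fun p j => (p.1 j, p.2 j)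
          invFun := fun q => (fun j => (q j).1, fun j => (q j).2)
          map_add' := fun _ _ => rfl
          map_smul' := fun _ _ => rfl
          left_inv := fun _ => rfl
          right_inv := fun _ => rfl }
      refine ⟨m, χ ≪≫ₗ (ψ.prodCongr ψ) ≪≫ₗ θ, ?_⟩
      have key : ∀ x j, (χ ≪≫ₗ (ψ.prodCongr ψ) ≪≫ₗ θ) x j = (ψ (P x) j, ψ (P (a x)) j) :=
        fun x j => rfl
      have hPe : ∀ i < 2 * k, ∀ x, P (e i x) = e' i (P x) := fun i hi x => by
        apply Subtype.ext
        rw [he' i hi, hP, hP]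
        simp [hea i hi, heb i hi]
      intro i hi x j
      rw [key, key]
      rcases cases i hi with h | rfl | rfl
      · rw [E1 i h, hPe i h, hψ i h]
        have : a (e i x) = - e i (a x) := by rw [hea i h]; simp
        rw [this, map_neg, hPe i h, map_neg, Pi.neg_apply, hψ i h]
      · rw [E2, ← ha, haa]
      · rw [E3, ← hb]
        have h1 : P (b x) = Complex.I • P (a x) := by
          apply Subtype.ext
          rw [Submodule.coe_smul, hP, hP]
          simp only [hba, haa, hbb, map_neg, smul_add, smul_neg, smul_smul]
          match_scalars
          · linear_combination (1/2 : ℂ) * Complex.I_mul_I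
          · ring
        have h2 : P (a (b x)) = - (Complex.I • P x) := by
          apply Subtype.ext
          rw [Submodule.coe_neg, Submodule.coe_smul, hP, hP]
          simp only [hba, haa, hbb, map_neg, smul_add, smul_neg, smul_smul]
          match_scalars
          · linear_combination (1/2 : ℂ) * Complex.I_mul_I
          · ring
        rw [h1, h2]; simp

def pr {A : Type} [Ring A] (e : ℕ → A) : ℕ → A
  | 0 => 1
  | n + 1 => pr e n * e n

theorem pr_anti {A : Type} [Ring A] (e : ℕ → A) (x : A) (n : ℕ)
    (h : ∀ i < n, x * e i = -(e i * x)) : x * pr e n = (-1) ^ n * (pr e n * x) := by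
  induction n with
  | zero => simp [pr]
  | succ n ih =>
    have ih := ih (fun i hi => h i (by omega))
    rw [pr, ← mul_assoc, ih, mul_assoc, mul_assoc, h n (by omega), pow_succ]
    simp [mul_assoc]

theorem pr_mem {A : Type} [Ring A] (e : ℕ → A) (n : ℕ) (h : CF e n) (i : ℕ) (hi : i < n) :
    e i * pr e n = (-1) ^ (n + 1) * (pr e n * e i) := by
  induction n with
  | zero => omega
  | succ n ih =>
    rcases Nat.lt_succ_iff_lt_or_eq.mp hi with h1 | rfl
    · have ih := ih (h.mono (by omega)) h1
      rw [pr, ← mul_assoc, ih, mul_assoc, mul_assoc, mul_assoc,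
        h.2 i (by omega) n (by omega) (by omega), pow_succ _ (n + 1)]
      simp
    · have := pr_anti e (e i) i (fun j hj => h.2 i (by omega) j (by omega) (by omega))
      rw [pr, ← mul_assoc, this, pow_succ, pow_succ]
      simp [mul_assoc]

theorem pr_sq (n : ℕ) : ∃ c : ℂ, ∀ (A : Type) [Ring A] [Algebra ℂ A] (e : ℕ → A), CF e n →
    (c • pr e n) * (c • pr e n) = 1 := by
  induction n with
  | zero => exact ⟨1, fun A _ _ e _ => by simp [pr]⟩
  | succ n ih =>
    obtain ⟨c, hc⟩ := ih
    obtain ⟨d, hd⟩ := IsAlgClosed.exists_eq_mul_self ((-1 : ℂ) ^ n)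
    refine ⟨c * d, fun A _ _ e he => ?_⟩
    have h1 := hc A e (he.mono (by omega))
    have h2 := pr_anti e (e n) n (fun j hj => he.2 n (by omega) j (by omega) (by omega))
    have h3 : pr e (n + 1) * pr e (n + 1) = (-1 : ℂ) ^ n • (pr e n * pr e n) := by
      rw [pr, mul_assoc, ← mul_assoc (e n), h2]
      rw [mul_assoc, mul_assoc, he.1 n (by omega), mul_one, ← mul_assoc,
        ← ((Commute.neg_one_left (pr e n)).pow_left n).eq, mul_assoc, Algebra.smul_def]
      simp
    rw [smul_mul_smul_comm] at h1 ⊢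
    rw [h3, smul_smul, ← h1]
    congr 1
    have hsq : ((-1 : ℂ) ^ n) * (-1) ^ n = 1 := by rw [← mul_pow]; simp
    rw [hd] at hsq ⊢
    linear_combination c * c * hsq

theorem pr_inter {X K : Type} [AddCommGroup X] [Module ℂ X] [AddCommGroup K] [Module ℂ K]
    (e : ℕ → Module.End ℂ X) (E : ℕ → Module.End ℂ K) (n : ℕ) (φ : X →ₗ[ℂ] K)
    (h : ∀ i < n, ∀ x, φ (e i x) = E i (φ x)) (x : X) : φ (pr e n x) = pr E n (φ x) := by
  induction n generalizing x with
  | zero => simp [pr]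
  | succ n ih =>
    simp only [pr, Module.End.mul_apply]
    rw [ih (fun i hi => h i (by omega)), h n (by omega)]

/-- extension of the even family by one more -/
noncomputable def OddExt {K : Type} [AddCommGroup K] [Module ℂ K] (E : ℕ → Module.End ℂ K)
    (k : ℕ) (d : ℂ) : ℕ → Module.End ℂ K :=
  fun i => if i < 2 * k then E i else d • pr E (2 * k)

theorem ext_CF {K : Type} [AddCommGroup K] [Module ℂ K] (E : ℕ → Module.End ℂ K)
    (k : ℕ) (d : ℂ) (hE : CF E (2 * k)) (hd : (d • pr E (2 * k)) * (d • pr E (2 * k)) = 1) :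
    CF (OddExt E k d) (2 * k + 1) := by
  have h1 : ∀ i < 2 * k, OddExt E k d i = E i := fun i hi => by simp [OddExt, hi]
  have h2 : OddExt E k d (2 * k) = d • pr E (2 * k) := by simp [OddExt]
  have h3 : ∀ i < 2 * k, E i * (d • pr E (2 * k)) = - ((d • pr E (2 * k)) * E i) := fun i hi => by
    have := pr_mem E (2 * k) hE i hi
    rw [pow_succ, pow_mul] at this
    rw [mul_smul_comm, this]
    simp
  refine ⟨fun i hi => ?_, fun i hi j hj hij => ?_⟩
  · rcases Nat.lt_succ_iff_lt_or_eq.mp hi with h | rfl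
    · rw [h1 i h, hE.1 i h]
    · rw [h2, hd]
  · rcases Nat.lt_succ_iff_lt_or_eq.mp hi with h | rfl <;>
    rcases Nat.lt_succ_iff_lt_or_eq.mp hj with h' | rfl
    · rw [h1 i h, h1 j h', hE.2 i h j h' hij]
    · rw [h1 i h, h2, h3 i h]
    · rw [h1 j h', h2, h3 j h', neg_neg]
    · exact absurd rfl hij

theorem pr_ext {K : Type} [AddCommGroup K] [Module ℂ K] (E : ℕ → Module.End ℂ K)
    (k : ℕ) (d : ℂ) : ∀ n ≤ 2 * k, pr (OddExt E k d) n = pr E n := by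
  intro n
  induction n with
  | zero => simp [pr]
  | succ n ih =>
    intro hn
    rw [pr, pr, ih (by omega)]
    congr 1
    simp only [OddExt]
    rw [if_pos (by omega)]

theorem half {k : ℕ} {K : Type} [AddCommGroup K] [Module ℂ K] {E : ℕ → Module.End ℂ K}
    (hU : IsModel k K E) (c δ : ℂ) (hδ : δ * δ = 1) (S : Type) [AddCommGroup S] [Module ℂ S]
    [FiniteDimensional ℂ S] (e : ℕ → Module.End ℂ S) (he : CF e (2 * k + 1))
    (ω : Module.End ℂ S) (hω : ω = (c • pr e (2 * k)) * e (2 * k))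
    (hc : ∀ i < 2 * k + 1, ∀ x, ω (e i x) = e i (ω x))
    (Y : Submodule ℂ S) (hY : ∀ x, x ∈ Y ↔ ω x = δ • x) :
    ∃ (m : ℕ) (φ : Y ≃ₗ[ℂ] (Fin m → K)), ∀ i < 2 * k + 1, ∀ x y : Y, (y : S) = e i x →
      ∀ j, φ y j = OddExt E k (δ * c) i (φ x j) := by
  have heY : ∀ i < 2 * k + 1, ∀ x ∈ Y, e i x ∈ Y := fun i hi x hx => by
    rw [hY] at hx ⊢
    rw [hc i hi, hx, map_smul]
  let e' : ℕ → Module.End ℂ Y := fun i =>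
    if h : i < 2 * k + 1 then (e i).restrict (heY i h) else 0
  have he' : ∀ i < 2 * k + 1, ∀ x : Y, (e' i x : S) = e i x := fun i hi x => by
    simp only [e']; rw [dif_pos hi]; rfl
  have he1 : ∀ i < 2 * k + 1, ∀ x, e i (e i x) = x := fun i hi x => by
    have := congrArg (fun f => f x) (he.1 i hi); simpa using this
  have he2 : ∀ i < 2 * k + 1, ∀ j < 2 * k + 1, i ≠ j → ∀ x, e i (e j x) = - e j (e i x) :=
    fun i hi j hj hij x => by
    have := congrArg (fun f => f x) (he.2 i hi j hj hij); simpa using this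
  have hCF : CF e' (2 * k + 1) := by
    refine ⟨fun i hi => ?_, fun i hi j hj hij => ?_⟩
    · ext x
      simp [he' i hi, he1 i (by omega)]
    · ext x
      simp [he' i hi, he' j hj, he2 i (by omega) j (by omega) hij]
  obtain ⟨m, φ, hφ⟩ := hU.2 Y e' (hCF.mono (by omega))
  refine ⟨m, φ, ?_⟩
  intro i hi x y hy j
  have hy' : y = e' i x := Subtype.ext (by rw [hy, he' i hi])
  rw [hy']
  rcases Nat.lt_succ_iff_lt_or_eq.mp hi with h | rfl
  · rw [hφ i h]; simp [OddExt, h]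
  · have h1 : e' (2 * k) x = (δ * c) • pr e' (2 * k) x := by
      apply Subtype.ext
      have h2 := pr_inter e' e (2 * k) Y.subtype (fun i hi x => he' i (by omega) x) x
      rw [Submodule.subtype_apply, Submodule.subtype_apply] at h2
      rw [Submodule.coe_smul, h2, he' _ hi]
      have h3 := (hY _).1 (heY _ hi x x.2)
      rw [hω, Module.End.mul_apply, he1 _ hi, LinearMap.smul_apply] at h3
      rw [mul_smul, h3, smul_smul, hδ, one_smul]
    have h2 := pr_inter e' E (2 * k) (LinearMap.proj j ∘ₗ φ.toLinearMap)
      (fun i hi x => hφ i hi x j) x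
    simp only [LinearMap.comp_apply, LinearMap.proj_apply, LinearEquiv.coe_coe] at h2
    rw [h1, map_smul, Pi.smul_apply, h2]
    simp [OddExt]

theorem odd_split {k : ℕ} {K : Type} [AddCommGroup K] [Module ℂ K] [FiniteDimensional ℂ K]
    {E : ℕ → Module.End ℂ K}
    (hU : IsModel k K E) (hK : Module.finrank ℂ K = 2 ^ k) (c : ℂ)
    (S : Type) [AddCommGroup S] [Module ℂ S]
    [FiniteDimensional ℂ S] (e : ℕ → Module.End ℂ S) (he : CF e (2 * k + 1))
    (hcc : (c • pr e (2 * k)) * (c • pr e (2 * k)) = 1)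
    (W : Module.End ℂ S) (hW : W * W = 1) (hWe : ∀ i < 2 * k + 1, W * e i = - (e i * W)) :
    ∃ (m : ℕ) (φ : S ≃ₗ[ℂ] (Fin m → K × K)), ∀ i < 2 * k + 1, ∀ s j,
      φ (e i s) j = (OddExt E k c i (φ s j).1, OddExt E k (-c) i (φ s j).2) := by
  obtain ⟨ω, hω⟩ : ∃ ω, ω = (c • pr e (2 * k)) * e (2 * k) := ⟨_, rfl⟩
  have hω' : ω = c • pr e (2 * k + 1) := by rw [hω, pr, smul_mul_assoc]
  have hωω : ω * ω = 1 := by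
    have h1 := pr_anti e (e (2 * k)) (2 * k)
      (fun j hj => he.2 _ (by omega) j (by omega) (by omega))
    rw [pow_mul] at h1
    simp only [even_two, Even.neg_pow, one_pow, one_mul] at h1
    have h2 : e (2 * k) * (c • pr e (2 * k)) = (c • pr e (2 * k)) * e (2 * k) := by
      rw [mul_smul_comm, h1, smul_mul_assoc]
    rw [hω, mul_assoc, ← mul_assoc (e (2 * k)), h2, mul_assoc, he.1 _ (by omega), mul_one, hcc]
  have hωe : ∀ i < 2 * k + 1, ∀ x, ω (e i x) = e i (ω x) := fun i hi x => by
    have h1 := pr_mem e _ he i hi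
    rw [show 2 * k + 1 + 1 = 2 * (k + 1) by ring, pow_mul] at h1
    simp only [even_two, Even.neg_pow, one_pow, one_mul] at h1
    have h2 : ω * e i = e i * ω := by rw [hω', smul_mul_assoc, ← h1, mul_smul_comm]
    exact congrArg (fun f => f x) h2
  have hωW : ∀ x, ω (W x) = - W (ω x) := fun x => by
    have h1 := pr_anti e W (2 * k + 1) hWe
    rw [pow_succ, pow_mul] at h1
    simp only [even_two, Even.neg_pow, one_pow, one_mul] at h1
    have h2 : ω * W = - (W * ω) := by rw [hω', mul_smul_comm, h1]; simp
    exact congrArg (fun f => f x) h2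
  have hωω' : ∀ x, ω (ω x) = x := fun x => congrArg (fun f => f x) hωω
  have hWW' : ∀ x, W (W x) = x := fun x => congrArg (fun f => f x) hW
  let Y : Submodule ℂ S := LinearMap.ker (ω - 1)
  let Z : Submodule ℂ S := LinearMap.ker (ω + 1)
  have hY : ∀ x, x ∈ Y ↔ ω x = x := fun x => by simp [Y, sub_eq_zero]
  have hZ : ∀ x, x ∈ Z ↔ ω x = -x := fun x => by simp [Z, add_eq_zero_iff_eq_neg]
  obtain ⟨m, φ, hφ⟩ := half hU c 1 (by ring) S e he ω hω hωe Y (fun x => by rw [hY, one_smul])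
  obtain ⟨m', φ', hφ'⟩ := half hU c (-1) (by ring) S e he ω hω hωe Z
    (fun x => by rw [hZ, neg_smul, one_smul])
  let τ : Y ≃ₗ[ℂ] Z := LinearEquiv.ofLinearMap
    (W.restrict (p := Y) (q := Z) (fun x hx => by
      rw [hY] at hx; rw [hZ, hωW, hx]))
    (W.restrict (p := Z) (q := Y) (fun x hx => by
      rw [hZ] at hx; rw [hY, hωW, hx]; simp))
    (by ext x; simp [hWW'])
    (by ext x; simp [hWW'])
  have hm : m = m' := by
    have h1 := φ.finrank_eq
    have h2 := φ'.finrank_eq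
    have h3 := τ.finrank_eq
    rw [h1, h2, Module.finrank_pi_fintype, Module.finrank_pi_fintype] at h3
    simp only [hK, Finset.sum_const, Finset.card_univ, Fintype.card_fin, smul_eq_mul] at h3
    exact Nat.eq_of_mul_eq_mul_right (by positivity) h3
  subst hm
  let P : S →ₗ[ℂ] Y := LinearMap.codRestrict Y ((1/2 : ℂ) • (1 + ω)) (fun x => by
    rw [hY]; simp [hωω', add_comm])
  let R : S →ₗ[ℂ] Z := LinearMap.codRestrict Z ((1/2 : ℂ) • (1 - ω)) (fun x => by
    rw [hZ]; simp only [LinearMap.smul_apply, LinearMap.sub_apply, Module.End.one_apply, map_smul,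
      map_sub, hωω']; module)
  have hP : ∀ x, (P x : S) = (1/2 : ℂ) • (x + ω x) := fun x => rfl
  have hR : ∀ x, (R x : S) = (1/2 : ℂ) • (x - ω x) := fun x => rfl
  let χ : S ≃ₗ[ℂ] Y × Z := LinearEquiv.ofLinearMap (P.prod R) (Y.subtype.coprod Z.subtype) (by
      apply LinearMap.ext
      rintro ⟨⟨x, hx⟩, ⟨y, hy⟩⟩
      rw [hY] at hx
      rw [hZ] at hy
      refine Prod.ext (Subtype.ext ?_) (Subtype.ext ?_)
      · change (P (x + y) : S) = x
        rw [hP, map_add, hx, hy]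
        module
      · change (R (x + y) : S) = y
        rw [hR, map_add, hx, hy]
        module) (by
      apply LinearMap.ext
      intro x
      change (P x : S) + (R x : S) = x
      rw [hP, hR]
      module)
  let θ : ((Fin m → K) × (Fin m → K)) ≃ₗ[ℂ] (Fin m → K × K) :=
    { toFun := fun p j => (p.1 j, p.2 j)
      invFun := fun q => (fun j => (q j).1, fun j => (q j).2)
      map_add' := fun _ _ => rfl
      map_smul' := fun _ _ => rfl
      left_inv := fun _ => rfl
      right_inv := fun _ => rfl }
  refine ⟨m, χ ≪≫ₗ (φ.prodCongr φ') ≪≫ₗ θ, fun i hi s j => ?_⟩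
  change (φ (P (e i s)) j, φ' (R (e i s)) j) = (OddExt E k c i (φ (P s) j), OddExt E k (-c) i (φ' (R s) j))
  have h1 := hφ i hi (P s) (P (e i s)) (by rw [hP, hP, hωe i hi]; simp) j
  have h2 := hφ' i hi (R s) (R (e i s)) (by rw [hR, hR, hωe i hi]; simp) j
  rw [h1, h2]
  simp

theorem exists_onb {M : Type} [AddCommGroup M] [Module ℂ M] [FiniteDimensional ℂ M]
    (Q : QuadraticForm ℂ M) (hQ : Q.polarBilin.Nondegenerate) :
    ∃ v : Module.Basis (Fin (Module.finrank ℂ M)) ℂ M,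
      ∀ i j, QuadraticMap.polar Q (v i) (v j) = if i = j then 2 else 0 := by
  have h1 : (QuadraticMap.associated (R := ℂ) Q).SeparatingLeft := by
    intro x hx
    apply hQ.1 x
    intro y
    have h2 := hx y
    rw [QuadraticMap.associated_apply] at h2
    rw [QuadraticMap.polarBilin_apply_apply, QuadraticMap.polar]
    simpa using h2
  obtain ⟨g⟩ := QuadraticForm.equivalent_weightedSumSquares_of_isAlgClosed Q h1
  refine ⟨(Pi.basisFun ℂ _).map g.toLinearEquiv.symm, fun i j => ?_⟩
  have h2 : ∀ x, Q (g.toLinearEquiv.symm x) = ∑ l, x l * x l := fun x => by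
    have := g.map_app (g.toLinearEquiv.symm x)
    rw [← this]
    have h3 : g (g.toLinearEquiv.symm x) = x := g.toLinearEquiv.apply_symm_apply x
    rw [h3, QuadraticMap.weightedSumSquares_apply]
    simp
  rw [QuadraticMap.polar, Module.Basis.map_apply, Module.Basis.map_apply, ← map_add, h2, h2, h2,
    ← Finset.sum_sub_distrib, ← Finset.sum_sub_distrib]
  simp only [Pi.basisFun_apply, Pi.add_apply]
  have h4 : ∀ x y : Fin (Module.finrank ℂ M) → ℂ, ∀ l, (x l + y l) * (x l + y l) - x l * x l -
      y l * y l = 2 * x l * y l := fun x y l => by ring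
  rw [Finset.sum_congr rfl (fun l _ => h4 _ _ l)]
  simp only [Pi.single_apply]
  simp [eq_comm]

theorem exists_onb' {M : Type} [AddCommGroup M] [Module ℂ M] [FiniteDimensional ℂ M]
    (Q : QuadraticForm ℂ M) (hQ : Q.polarBilin.Nondegenerate) (n : ℕ)
    (hn : Module.finrank ℂ M = n) :
    ∃ v : Module.Basis (Fin n) ℂ M,
      ∀ i j, QuadraticMap.polar Q (v i) (v j) = if i = j then 2 else 0 := by
  subst hn
  exact exists_onb Q hQ

theorem basis_sq {M : Type} [AddCommGroup M] [Module ℂ M] {n : ℕ}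
    (Q : QuadraticForm ℂ M) (v : Module.Basis (Fin n) ℂ M)
    (hv : ∀ i j, QuadraticMap.polar Q (v i) (v j) = if i = j then 2 else 0) (i : Fin n) :
    Q (v i) = 1 := by
  have := hv i i
  rw [QuadraticMap.polar_self] at this
  simpa using this

/-- the family of generators attached to a basis -/
noncomputable def fam {M A : Type} [AddCommGroup M] [Module ℂ M] [Ring A] [Algebra ℂ A] {n : ℕ}
    {Q : QuadraticForm ℂ M} (v : Module.Basis (Fin n) ℂ M) (f : CliffordAlgebra Q →ₐ[ℂ] A) :
    ℕ → A :=
  fun i => if h : i < n then f (CliffordAlgebra.ι Q (v ⟨i, h⟩)) else 0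

theorem fam_CF {M A : Type} [AddCommGroup M] [Module ℂ M] [Ring A] [Algebra ℂ A] {n : ℕ}
    {Q : QuadraticForm ℂ M} (v : Module.Basis (Fin n) ℂ M)
    (hv : ∀ i j, QuadraticMap.polar Q (v i) (v j) = if i = j then 2 else 0)
    (f : CliffordAlgebra Q →ₐ[ℂ] A) : CF (fam v f) n := by
  refine ⟨fun i hi => ?_, fun i hi j hj hij => ?_⟩
  · simp only [fam]
    rw [dif_pos hi, ← map_mul, CliffordAlgebra.ι_sq_scalar, basis_sq Q v hv]
    simp
  · simp only [fam]
    rw [dif_pos hi, dif_pos hj, ← map_mul f, ← map_mul f, eq_neg_iff_add_eq_zero, ← map_add f,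
      CliffordAlgebra.ι_mul_ι_add_swap, hv, if_neg (by simpa using hij)]
    simp

theorem lift_fam {M K : Type} [AddCommGroup M] [Module ℂ M] [AddCommGroup K] [Module ℂ K] {n : ℕ}
    {Q : QuadraticForm ℂ M} (v : Module.Basis (Fin n) ℂ M)
    (hv : ∀ i j, QuadraticMap.polar Q (v i) (v j) = if i = j then 2 else 0)
    (E : ℕ → Module.End ℂ K) (hE : CF E n) :
    ∃ ρ : CliffordAlgebra Q →ₐ[ℂ] Module.End ℂ K, ∀ i < n, fam v ρ i = E i := by
  let L : M →ₗ[ℂ] Module.End ℂ K := v.constr ℂ (fun i : Fin n => E i)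
  have hL : ∀ i, L (v i) = E i := fun i => by simp [L]
  have h1 : (LinearMap.mul ℂ (Module.End ℂ K)).compl₁₂ L L +
      ((LinearMap.mul ℂ (Module.End ℂ K)).compl₁₂ L L).flip =
      Q.polarBilin.compr₂ (Algebra.linearMap ℂ (Module.End ℂ K)) := by
    apply v.ext
    intro i
    apply v.ext
    intro j
    simp only [LinearMap.add_apply, LinearMap.compl₁₂_apply, LinearMap.flip_apply,
      LinearMap.mul_apply', LinearMap.compr₂_apply, QuadraticMap.polarBilin_apply_apply,
      Algebra.linearMap_apply, hL, hv]
    by_cases hij : i = j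
    · subst hij
      rw [hE.1 i i.2]
      rw [if_pos rfl, map_ofNat, one_add_one_eq_two]
    · rw [if_neg hij, hE.2 i i.2 j j.2 (fun h => hij (Fin.ext h))]
      simp
  have h2 : ∀ m, L m * L m = algebraMap ℂ _ (Q m) := fun m => by
    have := congrArg (fun f => f m m) h1
    simp only [LinearMap.add_apply, LinearMap.compl₁₂_apply, LinearMap.flip_apply,
      LinearMap.mul_apply', LinearMap.compr₂_apply, QuadraticMap.polarBilin_apply_apply,
      Algebra.linearMap_apply, QuadraticMap.polar_self] at this
    rw [← two_mul, two_smul, ← two_mul, map_mul, map_ofNat] at this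
    have h3 : (algebraMap ℂ (Module.End ℂ K) (1/2)) * 2 = 1 := by
      rw [← map_ofNat (algebraMap ℂ (Module.End ℂ K)) 2, ← map_mul]; norm_num
    have h4 := congrArg (fun t => algebraMap ℂ (Module.End ℂ K) (1/2) * t) this
    simp only [← mul_assoc] at h4
    rw [h3] at h4
    simpa using h4
  refine ⟨CliffordAlgebra.lift Q ⟨L, h2⟩, fun i hi => ?_⟩
  simp only [fam]
  rw [dif_pos hi, CliffordAlgebra.lift_ι_apply, hL]

theorem fam_ext {M X Y : Type} [AddCommGroup M] [Module ℂ M] [AddCommGroup X] [Module ℂ X]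
    [AddCommGroup Y] [Module ℂ Y] {n : ℕ}
    {Q : QuadraticForm ℂ M} (v : Module.Basis (Fin n) ℂ M)
    (ρ : CliffordAlgebra Q →ₐ[ℂ] Module.End ℂ X) (σ : CliffordAlgebra Q →ₐ[ℂ] Module.End ℂ Y)
    (φ : X →ₗ[ℂ] Y) (h : ∀ i < n, ∀ x, φ (fam v ρ i x) = fam v σ i (φ x))
    (a : CliffordAlgebra Q) : ∀ x, φ (ρ a x) = σ a (φ x) := by
  induction a using CliffordAlgebra.induction with
  | algebraMap r => intro x; simp [Module.algebraMap_end_apply]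
  | ι m =>
    intro x
    have h1 : (φ.compRight ℂ (M := X)) ∘ₗ ρ.toLinearMap ∘ₗ CliffordAlgebra.ι Q =
        (φ.lcomp ℂ Y) ∘ₗ σ.toLinearMap ∘ₗ CliffordAlgebra.ι Q := by
      apply v.ext
      intro i
      ext x
      have := h i i.2 x
      simp only [fam] at this
      rw [dif_pos i.2, dif_pos i.2] at this
      exact this
    exact congrArg (fun f => f m x) h1
  | mul a b ha hb => intro x; simp [ha, hb]
  | add a b ha hb => intro x; simp [ha, hb]

theorem simple_of_model {A T : Type} [Ring A] [Algebra ℂ A] [AddCommGroup T] [Module ℂ T]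
    [Module A T] [IsScalarTower ℂ A T] [FiniteDimensional ℂ T] (k : ℕ)
    (hT : Module.finrank ℂ T = 2 ^ k) (g : ℕ → A) (hg : CF g (2 * k)) : IsSimpleModule A T := by
  obtain ⟨K, _, _, _, E, hK, hU⟩ := exists_model k
  have : Nontrivial T := Module.nontrivial_of_finrank_pos (R := ℂ) (by rw [hT]; positivity)
  refine { exists_pair_ne := ⟨⊥, ⊤, bot_ne_top⟩, eq_bot_or_eq_top := fun U => ?_ }
  let U' : Submodule ℂ T := U.restrictScalars ℂ
  let e : ℕ → Module.End ℂ U' := fun i =>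
    (Algebra.lsmul ℂ ℂ T (g i)).restrict (p := U') (q := U') (fun x hx => U.smul_mem (g i) hx)
  have he : ∀ i (x : U'), (e i x : T) = g i • (x : T) := fun i x => rfl
  obtain ⟨m, φ, -⟩ := hU.2 U' e (by
    refine ⟨fun i hi => ?_, fun i hi j hj hij => ?_⟩
    · ext x
      simp [he, smul_smul, hg.1 i hi]
    · ext x
      simp [he, smul_smul, hg.2 i hi j hj hij])
  have h1 := φ.finrank_eq
  rw [Module.finrank_pi_fintype] at h1
  simp only [hK, Finset.sum_const, Finset.card_univ, Fintype.card_fin, smul_eq_mul] at h1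
  rcases Nat.eq_zero_or_pos m with rfl | hm
  · left
    rw [zero_mul, Submodule.finrank_eq_zero] at h1
    exact (Submodule.restrictScalars_eq_bot_iff ℂ A T).1 h1
  · right
    have h2 : U' = ⊤ := Submodule.eq_top_of_finrank_eq (le_antisymm (Submodule.finrank_le _) (by
      rw [hT, h1]; exact Nat.le_mul_of_pos_left _ hm))
    exact (Submodule.restrictScalars_eq_top_iff ℂ A T).1 h2

theorem finrank_simple {V : Type} [AddCommGroup V] [Module ℂ V] {h : ℕ}
    (Q : QuadraticForm ℂ V) (v : Module.Basis (Fin (2 * h)) ℂ V)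
    (hv : ∀ i j, QuadraticMap.polar Q (v i) (v j) = if i = j then 2 else 0)
    (S : Type) [AddCommGroup S] [Module ℂ S] [Module (CliffordAlgebra Q) S]
    [IsScalarTower ℂ (CliffordAlgebra Q) S] [FiniteDimensional ℂ S]
    (hS : IsSimpleModule (CliffordAlgebra Q) S) : Module.finrank ℂ S = 2 ^ h := by
  obtain ⟨K, _, _, _, E, hK, hU⟩ := exists_model h
  have : Nontrivial K := Module.nontrivial_of_finrank_pos (R := ℂ) (by rw [hK]; positivity)
  obtain ⟨t, ht⟩ := exists_ne (0 : K)
  have : Nontrivial S := IsSimpleModule.nontrivial (CliffordAlgebra Q) S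
  let f : CliffordAlgebra Q →ₐ[ℂ] Module.End ℂ S := Algebra.lsmul ℂ ℂ S
  obtain ⟨m, φ, hφ⟩ := hU.2 S (fam v f) (fam_CF v hv f)
  obtain ⟨σ, hσ⟩ := lift_fam v hv E hU.1
  have key : ∀ (a : CliffordAlgebra Q) s j, φ (a • s) j = σ a (φ s j) := fun a s j =>
    fam_ext v f σ (LinearMap.proj j ∘ₗ φ.toLinearMap) (fun i hi x => by
      rw [hσ i hi]; exact hφ i hi x j) a s
  have hm : 0 < m := by
    rcases Nat.eq_zero_or_pos m with rfl | hm
    · exact absurd φ.toEquiv.subsingleton (not_subsingleton S)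
    · exact hm
  let U : Submodule (CliffordAlgebra Q) S :=
    { carrier := {s | ∀ j, j ≠ ⟨0, hm⟩ → φ s j = 0}
      add_mem' := fun {a b} ha hb j hj => by simp [ha j hj, hb j hj]
      zero_mem' := fun j hj => by simp
      smul_mem' := fun a s hs j hj => by rw [key, hs j hj, map_zero] }
  have hmem : ∀ s, s ∈ U ↔ ∀ j, j ≠ ⟨0, hm⟩ → φ s j = 0 := fun s => Iff.rfl
  have hm1 : m = 1 := by
    rcases eq_bot_or_eq_top U with h0 | h0
    · exfalso
      have : φ.symm (Pi.single ⟨0, hm⟩ t) ∈ U := by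
        rw [hmem]; intro j hj; simp [Pi.single_apply, hj]
      rw [h0, Submodule.mem_bot] at this
      have h2 := congrArg (fun s => φ s ⟨0, hm⟩) this
      simp at h2
      exact ht h2
    · by_contra hne
      have h1 : 1 < m := by omega
      have : φ.symm (Pi.single ⟨1, h1⟩ t) ∈ U := by rw [h0]; trivial
      rw [hmem] at this
      have h2 := this ⟨1, h1⟩ (by simp)
      simp at h2
      exact ht h2
  have h1 := φ.finrank_eq
  rw [Module.finrank_pi_fintype] at h1
  simp only [hK, Finset.sum_const, Finset.card_univ, Fintype.card_fin, smul_eq_mul] at h1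
  rw [h1, hm1, one_mul]

/-- Let `V` be a finite-dimensional complex vector space with nondegenerate quadratic form `Q`,
and `V = M ⊕ N` a decomposition orthogonal for the associated bilinear form, with nondegenerate
restrictions `Q_M`, `Q_N`.  Assume `dim V` is even and `dim M` is odd.  Then for every
finite-dimensional simple `C(Q)`-module `S` there are two non-isomorphic simple
`C(Q_M)`-modules `S⁺`, `S⁻` such that `S`, viewed as a `C(Q_M)`-module via the map
`C(Q_M) → C(Q)` induced by the inclusion `M ↪ V`, is isomorphic to the direct sum of
`2^{(dim N − 1)/2}` copies of `S⁺ ⊕ S⁻`. -/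
theorem stmt_8 (V : Type) [AddCommGroup V] [Module ℂ V] [FiniteDimensional ℂ V]
    (Q : QuadraticForm ℂ V) (hQ : Q.polarBilin.Nondegenerate)
    (M N : Submodule ℂ V) (hMN : IsCompl M N)
    (horth : ∀ x ∈ M, ∀ y ∈ N, QuadraticMap.polar Q x y = 0)
    (hQM : (qfRes Q M).polarBilin.Nondegenerate)
    (hQN : (qfRes Q N).polarBilin.Nondegenerate)
    (hV : Even (Module.finrank ℂ V)) (hM : Odd (Module.finrank ℂ M))
    (S : Type) [AddCommGroup S] [Module ℂ S] [Module (CliffordAlgebra Q) S]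
    [IsScalarTower ℂ (CliffordAlgebra Q) S] [FiniteDimensional ℂ S]
    (hS : IsSimpleModule (CliffordAlgebra Q) S) :
    ∃ (Tp Tm : Type) (_ : AddCommGroup Tp) (_ : AddCommGroup Tm)
      (_ : Module (CliffordAlgebra (qfRes Q M)) Tp)
      (_ : Module (CliffordAlgebra (qfRes Q M)) Tm),
      IsSimpleModule (CliffordAlgebra (qfRes Q M)) Tp ∧
      IsSimpleModule (CliffordAlgebra (qfRes Q M)) Tm ∧
      ¬ Nonempty (Tp ≃ₗ[CliffordAlgebra (qfRes Q M)] Tm) ∧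
      ∃ e : S ≃+ (Fin (2 ^ ((Module.finrank ℂ N - 1) / 2)) → Tp × Tm),
        ∀ (a : CliffordAlgebra (qfRes Q M)) (s : S),
          e (CliffordAlgebra.map (qfIncl Q M) a • s) = a • e s := by
  obtain ⟨h, hh⟩ := hV
  obtain ⟨k, hk⟩ := hM
  have hdim := Submodule.finrank_add_eq_of_isCompl hMN
  obtain ⟨l, hl⟩ : ∃ l, Module.finrank ℂ N = 2 * l + 1 := ⟨h - k - 1, by omega⟩
  have hhkl : h = k + l + 1 := by omega
  obtain ⟨vV, hvV⟩ := exists_onb' Q hQ (2 * h) (by omega)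
  obtain ⟨vM, hvM⟩ := exists_onb' (qfRes Q M) hQM (2 * k + 1) hk
  obtain ⟨vN, hvN⟩ := exists_onb' (qfRes Q N) hQN (2 * l + 1) hl
  have hSd := finrank_simple Q vV hvV S hS
  obtain ⟨K, _, _, _, E, hK, hU⟩ := exists_model k
  have : Nontrivial K := Module.nontrivial_of_finrank_pos (R := ℂ) (by rw [hK]; positivity)
  obtain ⟨c, hc⟩ := pr_sq (2 * k)
  let f : CliffordAlgebra Q →ₐ[ℂ] Module.End ℂ S := Algebra.lsmul ℂ ℂ S
  let fM : CliffordAlgebra (qfRes Q M) →ₐ[ℂ] Module.End ℂ S :=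
    f.comp (CliffordAlgebra.map (qfIncl Q M))
  have hfM : CF (fam vM fM) (2 * k + 1) := fam_CF vM hvM fM
  let w : V := vN ⟨0, by omega⟩
  have hw : Q w = 1 := basis_sq (qfRes Q N) vN hvN ⟨0, by omega⟩
  have hwN : w ∈ N := (vN ⟨0, by omega⟩).2
  let W : Module.End ℂ S := f (CliffordAlgebra.ι Q w)
  have hWW : W * W = 1 := by
    simp only [W]
    rw [← map_mul, CliffordAlgebra.ι_sq_scalar, hw]; simp
  have hWe : ∀ i < 2 * k + 1, W * fam vM fM i = - (fam vM fM i * W) := fun i hi => by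
    simp only [W, fam]
    rw [dif_pos hi]
    have h1 : fM (CliffordAlgebra.ι (qfRes Q M) (vM ⟨i, hi⟩)) =
        f (CliffordAlgebra.ι Q (vM ⟨i, hi⟩ : V)) := by
      simp only [fM, AlgHom.comp_apply, CliffordAlgebra.map_apply_ι]
      rfl
    rw [h1, ← map_mul f, ← map_mul f, eq_neg_iff_add_eq_zero, ← map_add f,
      CliffordAlgebra.ι_mul_ι_add_swap, QuadraticMap.polar_comm, horth _ (vM ⟨i, hi⟩).2 w hwN]
    simp
  obtain ⟨m, φ, hφ⟩ := odd_split hU hK c S (fam vM fM) hfM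
    (hc _ _ (hfM.mono (by omega))) W hWW hWe
  have hm : m = 2 ^ ((Module.finrank ℂ N - 1) / 2) := by
    have h1 := φ.finrank_eq
    rw [Module.finrank_pi_fintype] at h1
    simp only [Module.finrank_prod, hK, Finset.sum_const, Finset.card_univ, Fintype.card_fin,
      smul_eq_mul] at h1
    rw [hSd, hhkl] at h1
    have h2 : (Module.finrank ℂ N - 1) / 2 = l := by omega
    rw [h2]
    have h3 : 2 ^ l * 2 ^ (k + 1) = m * 2 ^ (k + 1) := by
      rw [← pow_add, show l + (k + 1) = k + l + 1 by ring, h1]; ring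
    exact (Nat.eq_of_mul_eq_mul_right (by positivity) h3).symm
  subst hm
  have hcE := hc _ E hU.1
  have hEp := ext_CF E k c hU.1 hcE
  have hEm := ext_CF E k (-c) hU.1 (by rw [neg_smul, neg_mul_neg, hcE])
  obtain ⟨ρp, hρp⟩ := lift_fam vM hvM _ hEp
  obtain ⟨ρm, hρm⟩ := lift_fam vM hvM _ hEm
  have gCF : CF (fam vM (AlgHom.id ℂ (CliffordAlgebra (qfRes Q M)))) (2 * k + 1) := fam_CF vM hvM _
  have simpleK : ∀ ρ : CliffordAlgebra (qfRes Q M) →ₐ[ℂ] Module.End ℂ K,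
      @IsSimpleModule (CliffordAlgebra (qfRes Q M)) _ K _
        (Module.compHom K (ρ : CliffordAlgebra (qfRes Q M) →+* Module.End ℂ K)) := fun ρ => by
    letI : Module (CliffordAlgebra (qfRes Q M)) K :=
      Module.compHom K (ρ : CliffordAlgebra (qfRes Q M) →+* Module.End ℂ K)
    have hsm : ∀ (a : CliffordAlgebra (qfRes Q M)) (x : K), a • x = ρ a x := fun _ _ => rfl
    haveI : IsScalarTower ℂ (CliffordAlgebra (qfRes Q M)) K :=
      ⟨fun r a x => by rw [hsm, hsm, map_smul]; rfl⟩
    exact simple_of_model k hK _ (gCF.mono (by omega))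
  refine ⟨K, K, inferInstance, inferInstance,
    Module.compHom K (ρp : CliffordAlgebra (qfRes Q M) →+* Module.End ℂ K),
    Module.compHom K (ρm : CliffordAlgebra (qfRes Q M) →+* Module.End ℂ K),
    simpleK ρp, simpleK ρm, ?_, φ.toAddEquiv, ?_⟩
  · rintro ⟨g⟩
    let g' : K → K := g
    have hgadd : ∀ x y, g' (x + y) = g' x + g' y := fun x y => g.map_add x y
    have hg : ∀ a x, g' (ρp a x) = ρm a (g' x) := fun a x => g.map_smul a x
    have hginj : Function.Injective g' := g.injective
    let G : K →ₗ[ℂ] K :=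
      { toFun := g'
        map_add' := hgadd
        map_smul' := fun r x => by
          have := hg (algebraMap ℂ _ r) x
          rwa [AlgHom.commutes, AlgHom.commutes, Module.algebraMap_end_apply,
            Module.algebraMap_end_apply] at this }
    have hG : ∀ i < 2 * k + 1, ∀ x, G (OddExt E k c i x) = OddExt E k (-c) i (G x) :=
      fun i hi x => by
        rw [← hρp i hi, ← hρm i hi]
        simp only [fam]
        rw [dif_pos hi, dif_pos hi]
        exact hg _ x
    have h1 := pr_inter E E (2 * k) G (fun i hi x => by
      have := hG i (by omega) x
      simpa [OddExt, hi] using this)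
    obtain ⟨t, ht⟩ := exists_ne (0 : K)
    have h2 := hG (2 * k) (by omega) t
    simp only [OddExt, lt_irrefl, if_false, LinearMap.smul_apply, map_smul, h1] at h2
    have h3 : (c • pr E (2 * k)) (G t) = 0 := by
      rw [LinearMap.smul_apply]
      rw [neg_smul] at h2
      have h6 : (2 : ℂ) • (c • pr E (2 * k) (G t)) = 0 := by
        rw [two_smul]
        nth_rewrite 1 [h2]
        exact neg_add_cancel _
      exact (smul_eq_zero.mp h6).resolve_left two_ne_zero
    have h4 : ((c • pr E (2 * k)) * (c • pr E (2 * k))) (G t) = 0 := by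
      rw [Module.End.mul_apply, h3, map_zero]
    rw [hcE, Module.End.one_apply] at h4
    apply ht
    apply hginj
    have h5 : g' 0 = 0 := G.map_zero
    rw [h5]
    exact h4
  · intro a s
    funext j
    have h1 := fam_ext vM fM ρp (LinearMap.fst ℂ K K ∘ₗ LinearMap.proj j ∘ₗ φ.toLinearMap)
      (fun i hi x => by
        rw [hρp i hi]
        exact congrArg Prod.fst (hφ i hi x j)) a s
    have h2 := fam_ext vM fM ρm (LinearMap.snd ℂ K K ∘ₗ LinearMap.proj j ∘ₗ φ.toLinearMap)
      (fun i hi x => by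
        rw [hρm i hi]
        exact congrArg Prod.snd (hφ i hi x j)) a s
    exact Prod.ext h1 h2
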